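/- Let (N,P) be a local C^1-fibered flow over a topological flow (K,φ) on a compact metric space, with an identification π compatible with (P_t) on an open set U ⊂ K with constant r₀. Then there exists r₀' ∈ (0,r₀] such that for every x ∈ U, every increasing homeomorphism θ of ℝ, and every interval I containing 0 satisfying φ_{θ(0)}(x) ∈ U and d(φ_t(x), φ_{θ(t)}(x)) ≤ r₀' for all t ∈ I: (i) if θ(0) > 1/2 then θ(t) > t+2 for every t ∈ I such that φ_t(x) ∈ U and φ_{θ(t)}(x) ∈ U; (ii) if θ(0) ∈ [−2,2] then θ(t) ∈ [t−1/2, t+1/2] for every such t; (iii) if θ(0) < −1/2 then θ(t) < t−2 for every such t. -/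

import Mathlib

noncomputable section

open Set Filter Metric

/-- The model fiber of the bundle (the bundle is trivialized). -/
abbrev Fib (d : ℕ) : Type := EuclideanSpace ℝ (Fin d)

/-- A local `C^k`-fibered flow over a topological flow `φ` on a metric space `K`:
a continuous family of `C^k`-diffeomorphisms `P t x : N_x → N_{φ t x}` preserving the
zero section, satisfying the local flow property at scale `β₀`. -/
structure LocalFiberedFlow (K : Type) [MetricSpace K] (d : ℕ) (k : ℕ) : Type where
  φ : ℝ → K → K
  φ_cont : Continuous fun p : ℝ × K => φ p.1 p.2
  φ_zero : ∀ x, φ 0 x = x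
  φ_add : ∀ s t x, φ (s + t) x = φ s (φ t x)
  P : ℝ → K → Fib d → Fib d
  P_cont : Continuous fun p : (ℝ × K) × Fib d => P p.1.1 p.1.2 p.2
  P_zero : ∀ t x, P t x 0 = 0
  P_bij : ∀ t x, Function.Bijective (P t x)
  P_smooth : ∀ t x, ContDiff ℝ k (P t x)
  P_inv_smooth : ∀ t x, ContDiff ℝ k (Function.invFun (P t x))
  β₀ : ℝ
  β₀_pos : 0 < β₀
  P_loc_flow : ∀ (x : K) (t₁ t₂ : ℝ) (u : Fib d),
    (∀ s ∈ Set.Icc (0:ℝ) 1, ‖P (s * t₁) x u‖ ≤ β₀) →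
    (∀ s ∈ Set.Icc (0:ℝ) 1, ‖P (s * t₂) (φ t₁ x) (P t₁ x u)‖ ≤ β₀) →
    P (t₁ + t₂) x u = P t₂ (φ t₁ x) (P t₁ x u)

variable {K : Type} [MetricSpace K] {d k : ℕ}

/-- The linear flow `DP_t(0_x)` obtained by differentiating along the fibers at the
zero section. -/
def LocalFiberedFlow.DP (L : LocalFiberedFlow K d k) (t : ℝ) (x : K) :
    Fib d →L[ℝ] Fib d :=
  fderiv ℝ (L.P t x) 0

/-- A dominated splitting `N = E ⊕ F` over an invariant subset `Λ` for the linear flow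
`DP_t(0)` of a local fibered flow. -/
structure DominatedSplittingOn (L : LocalFiberedFlow K d k) (Λ : Set K) : Type where
  E : K → Submodule ℝ (Fib d)
  F : K → Submodule ℝ (Fib d)
  E_ne : ∀ x ∈ Λ, E x ≠ ⊥
  F_ne : ∀ x ∈ Λ, F x ≠ ⊥
  compl : ∀ x ∈ Λ, IsCompl (E x) (F x)
  E_inv : ∀ (t : ℝ), ∀ x ∈ Λ, ∀ u ∈ E x, L.DP t x u ∈ E (L.φ t x)
  F_inv : ∀ (t : ℝ), ∀ x ∈ Λ, ∀ v ∈ F x, L.DP t x v ∈ F (L.φ t x)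
  τ₀ : ℝ
  τ₀_pos : 0 < τ₀
  dom : ∀ x ∈ Λ, ∀ t ≥ τ₀, ∀ u ∈ E x, ∀ v ∈ F x, ‖u‖ = 1 → ‖v‖ = 1 →
    ‖L.DP t x u‖ ≤ (1/2) * ‖L.DP t x v‖

/-- The bundle `E` is uniformly contracted on the set `V`: there is `t₀ > 0` such that
`‖DP_{t₀}(0_x)|_{E(x)}‖ ≤ 1/2` for every `x` whose orbit segment of length `t₀` stays in `V`. -/
def UnifContractedOn (L : LocalFiberedFlow K d k)
    (E : K → Submodule ℝ (Fib d)) (V : Set K) : Prop :=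
  ∃ t₀ > 0, ∀ x : K, (∀ t ∈ Set.Icc (0:ℝ) t₀, L.φ t x ∈ V) →
    ‖(L.DP t₀ x).comp (E x).subtypeL‖ ≤ 1/2

/-- The bundle `E` is uniformly contracted over an invariant set `Λ`. -/
def UnifContractedOver (L : LocalFiberedFlow K d k)
    (E : K → Submodule ℝ (Fib d)) (Λ : Set K) : Prop :=
  ∃ t₀ > 0, ∀ x ∈ Λ, ‖(L.DP t₀ x).comp (E x).subtypeL‖ ≤ 1/2

/-- A periodic orbit of the flow. -/
def IsPeriodicOrbit (L : LocalFiberedFlow K d k) (O : Set K) : Prop :=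
  ∃ (x : K) (T : ℝ), 0 < T ∧ L.φ T x = x ∧ O = Set.range fun t => L.φ t x

/-- A `C^k`-identification on an open set `U ⊆ K`: a continuous family of
`C^k`-diffeomorphisms `π x y : N_y → N_x` (for `x ∈ U` and `d(x,y) < r₀`)
satisfying the cocycle relation near the zero section. -/
structure Identification (L : LocalFiberedFlow K d k) (U : Set K) : Type where
  r₀ : ℝ
  r₀_pos : 0 < r₀
  β₁ : ℝ
  β₁_pos : 0 < β₁
  π : K → K → Fib d → Fib d
  π_cont : Continuous fun p : (K × K) × Fib d => π p.1.1 p.1.2 p.2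
  π_smooth : ∀ x y, ContDiff ℝ k (π x y)
  π_bij : ∀ x y, Function.Bijective (π x y)
  π_inv_smooth : ∀ x y, ContDiff ℝ k (Function.invFun (π x y))
  π_comp : ∀ x y z : K, x ∈ U → z ∈ U →
    dist x y < r₀ → dist x z < r₀ → dist y z < r₀ →
    ∀ u : Fib d, ‖u‖ < β₁ → π x z (π z y u) = π x y u

/-- An orientation-preserving bi-Lipschitz homeomorphism of `ℝ` whose Lipschitz
constants (of itself and of its inverse) are at most `c`. -/
def LipHomeo (c : ℝ) (θ : ℝ → ℝ) : Prop :=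
  StrictMono θ ∧ Function.Surjective θ ∧
  (∀ a b : ℝ, |θ a - θ b| ≤ c * |a - b|) ∧ (∀ a b : ℝ, |a - b| ≤ c * |θ a - θ b|)

/-- Compatibility of an identification with the local fibered flow
(Transverse boundary, No small period, Local injectivity, Local invariance,
Global invariance). -/
structure Compatible (L : LocalFiberedFlow K d k) (U : Set K)
    (ident : Identification L U) : Prop where
  transverse_boundary : ∀ (x : K) (t : ℝ), 0 < t →
    (∀ s ∈ Set.Icc (-t) t, L.φ s x ∉ U) → x ∉ closure U
  no_small_period : ∀ κ > 0, ∃ r > 0, ∀ x ∈ closure U, ∀ t ∈ Set.Icc (-2:ℝ) 2,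
    dist x (L.φ t x) < r → |t| < κ
  loc_inj : ∀ δ > 0, ∃ β > 0, ∀ x ∈ U, ∀ y ∈ U,
    dist x y < ident.r₀ → ‖ident.π x y 0‖ ≤ β →
    ∃ t ∈ Set.Icc (-(1/4) : ℝ) (1/4), dist (L.φ t y) x ≤ δ
  loc_inv : ∀ x ∈ U, ∀ y ∈ U, ∀ t ∈ Set.Icc (-2:ℝ) 2,
    dist y x < ident.r₀ → dist (L.φ t y) x < ident.r₀ →
    ∀ u : Fib d, ‖u‖ < ident.β₁ → ident.π x (L.φ t y) (L.P t y u) = ident.π x y u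
  glob_inv : ∀ δ > 0, ∀ ρ > 0, ∃ r > 0, ∃ β > 0,
    ∀ y ∈ U, ∀ y' : K, dist y y' < r → ∀ u u' : Fib d, ident.π y y' u' = u →
    ∀ I I' : Set ℝ, I.OrdConnected → I'.OrdConnected → (0:ℝ) ∈ I → (0:ℝ) ∈ I' →
    (∀ s ∈ I, ‖L.P s y u‖ < β) → (∀ s' ∈ I', ‖L.P s' y' u'‖ < β) →
    ∃ θ : ℝ → ℝ, LipHomeo (1 + ρ) θ ∧ θ 0 = 0 ∧
      (∀ s ∈ I ∩ θ ⁻¹' I', dist (L.φ s y) (L.φ (θ s) y') < δ) ∧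
      ∀ v : Fib d, (∀ s ∈ I ∩ θ ⁻¹' I', ‖L.P s y v‖ < β) →
        (∀ s ∈ I ∩ θ ⁻¹' I', ‖L.P (θ s) y' (ident.π y' y v)‖ < δ) ∧
        (∀ s ∈ I ∩ θ ⁻¹' I', L.φ s y ∈ U →
          ident.π (L.φ s y) (L.φ (θ s) y') (L.P (θ s) y' (ident.π y' y v)) = L.P s y v)

/-- Quantitative transversality of a curve `f` to a closed set `A` at scales `η` (time)
and `r` (space): returns of time at most `2` near `A` take time less than `η`, a point
close to `A` meets `A` within time `η`, and a unit displacement close to `A` cannot be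
shadowed by a displacement of time at most `2 * η`. -/
structure TransverseCurve (f : ℝ → K) (A : Set K) (η r : ℝ) : Prop where
  cont : Continuous f
  no_short_return : ∀ s u, f s ∈ A → |u| ≤ 2 → dist (f s) (f (s + u)) ≤ r → |u| < η
  meets : ∀ s s', f s ∈ A → dist (f s) (f s') ≤ r → ∃ u, |u| ≤ η ∧ f (s' + u) ∈ A
  no_stall : ∀ e s s' v, |e| = 1 → (f s ∈ A ∨ f s' ∈ A) → dist (f s) (f s') ≤ r →
    dist (f (s + e)) (f v) ≤ r → |v - s'| ≤ 2 * η → False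

theorem TransverseCurve.comp_neg {f : ℝ → K} {A : Set K} {η r : ℝ}
    (h : TransverseCurve f A η r) : TransverseCurve (fun s => f (-s)) A η r where
  cont := h.cont.comp continuous_neg
  no_short_return s u hs hu hd := by
    have := h.no_short_return (-s) (-u) hs (by rwa [abs_neg])
      (by rwa [neg_add] at hd)
    rwa [abs_neg] at this
  meets s s' hs hd := by
    obtain ⟨u, hu, hA⟩ := h.meets (-s) (-s') hs hd
    exact ⟨-u, by rwa [abs_neg], by rwa [neg_add, neg_neg]⟩
  no_stall e s s' v he hA hd hd' hv := by
    refine h.no_stall (-e) (-s) (-s') (-v) (by rwa [abs_neg]) hA hd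
      (by rwa [neg_add] at hd') ?_
    rwa [← abs_neg, show -(-v - -s') = v - s' by ring]

/-- A reparametrization shadowing the identity along a transverse curve with a shift at
least `2` near `A` keeps a positive shift in the future. -/
theorem TransverseCurve.shift_lt {f : ℝ → K} {A : Set K} {η r : ℝ}
    (h : TransverseCurve f A η r) (hAc : IsClosed A) (hη : 0 < η) (hη' : η ≤ 1 / 4)
    {g : ℝ → ℝ} (hg : StrictMono g) (hgc : Continuous g) {p c : ℝ} (hpc : p ≤ c)
    (hd : ∀ s ∈ Icc p c, dist (f s) (f (g s)) ≤ r)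
    (hA : f p ∈ A ∨ f (g p) ∈ A) (hp : p + 2 ≤ g p) : c + η < g c := by
  by_contra! hc
  obtain ⟨a, ⟨⟨⟨hpa, hac⟩, haA⟩, ha⟩, hamax⟩ :
      ∃ a, IsGreatest ((Icc p c ∩ {s | f s ∈ A ∨ f (g s) ∈ A}) ∩ {s | s + 2 ≤ g s}) a := by
    refine IsCompact.exists_isGreatest ((isCompact_Icc.inter_right ?_).inter_right ?_)
      ⟨p, ⟨⟨le_rfl, hpc⟩, hA⟩, hp⟩
    · exact (hAc.preimage h.cont).union (hAc.preimage (h.cont.comp hgc))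
    · exact isClosed_le (by fun_prop) hgc
  obtain ⟨b, ⟨⟨hab, hbc⟩, hb⟩, hbmin⟩ :
      ∃ b, IsLeast (Icc a c ∩ {s | g s ≤ s + η}) b := by
    refine IsCompact.exists_isLeast (isCompact_Icc.inter_right ?_) ⟨c, ⟨hac, le_rfl⟩, hc⟩
    exact isClosed_le hgc (by fun_prop)
  simp only [mem_ofPred_eq] at haA ha hb
  have hfree : ∀ s, a < s → s < b → f s ∉ A := by
    intro s has hsb hsA
    have hs : s + η < g s := by
      by_contra! hs
      exact absurd (hbmin ⟨⟨has.le, (hsb.trans_le hbc).le⟩, hs⟩) (not_le.2 hsb)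
    have hds := hd s ⟨hpa.trans has.le, (hsb.trans_le hbc).le⟩
    have hs2 : s + 2 ≤ g s := by
      by_contra! hs2
      have := h.no_short_return s (g s - s) hsA (abs_le.2 ⟨by linarith, by linarith⟩)
        (by rwa [add_sub_cancel])
      linarith [le_abs_self (g s - s)]
    exact absurd (hamax ⟨⟨⟨hpa.trans has.le, (hsb.trans_le hbc).le⟩, Or.inl hsA⟩, hs2⟩)
      (not_le.2 has)
  have hgab : g a ≤ g b := hg.monotone hab
  have hga : b - η ≤ g a := by
    by_contra! hlt
    have hfa : f a ∈ A := haA.resolve_right (hfree _ (by linarith) (by linarith))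
    obtain ⟨u, hu, huA⟩ := h.meets a (g a) hfa (hd a ⟨hpa, hac⟩)
    obtain ⟨hu1, hu2⟩ := abs_le.1 hu
    exact hfree _ (by linarith) (by linarith) huA
  have h1 : g a < g (a + 1) := hg (by linarith)
  have h2 : g (a + 1) ≤ g b := hg.monotone (by linarith)
  exact h.no_stall 1 a (g a) (g (a + 1)) abs_one haA (hd a ⟨hpa, hac⟩)
    (hd _ ⟨by linarith, by linarith⟩) (abs_le.2 ⟨by linarith, by linarith⟩)

theorem TransverseCurve.shift_gt {f : ℝ → K} {A : Set K} {η r : ℝ}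
    (h : TransverseCurve f A η r) (hAc : IsClosed A) (hη : 0 < η) (hη' : η ≤ 1 / 4)
    (g : ℝ ≃o ℝ) {p c : ℝ} (hpc : p ≤ c)
    (hd : ∀ s ∈ Icc p c, dist (f s) (f (g s)) ≤ r)
    (hA : f p ∈ A ∨ f (g p) ∈ A) (hp : g p + 2 ≤ p) : g c + η < c := by
  have := h.shift_lt hAc hη hη' g.symm.strictMono g.symm.continuous (p := g p) (c := g c)
    (g.monotone hpc) ?_ (by simpa using hA.symm) (by simpa using hp)
  · simpa using this
  · intro s hs
    have := hd (g.symm s) ⟨g.le_symm_apply.2 hs.1, g.symm_apply_le.2 hs.2⟩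
    rw [g.apply_symm_apply] at this
    rwa [dist_comm]

/-- A shift of size at least `2` near `A` keeps its sign, both in the past and in the future. -/
theorem TransverseCurve.shift_sign {f : ℝ → K} {A : Set K} {η r : ℝ}
    (h : TransverseCurve f A η r) (hAc : IsClosed A) (hη : 0 < η) (hη' : η ≤ 1 / 4)
    (g : ℝ ≃o ℝ) {p c : ℝ}
    (hd : ∀ s ∈ uIcc p c, dist (f s) (f (g s)) ≤ r)
    (hA : f p ∈ A ∨ f (g p) ∈ A) :
    (p + 2 ≤ g p → c + η < g c) ∧ (g p + 2 ≤ p → g c + η < c) := by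
  rcases le_total p c with hpc | hcp
  · rw [uIcc_of_le hpc] at hd
    exact ⟨h.shift_lt hAc hη hη' g.strictMono g.continuous hpc hd hA,
      h.shift_gt hAc hη hη' g hpc hd hA⟩
  · rw [uIcc_of_ge hcp] at hd
    have hmono : StrictMono fun s => -g (-s) := fun a b hab =>
      neg_lt_neg (g.strictMono (neg_lt_neg hab))
    have hsurj : Function.Surjective fun s => -g (-s) := fun y =>
      ⟨-g.symm (-y), by simp⟩
    have hd' : ∀ s ∈ Icc (-p) (-c), dist (f (-s)) (f (- -g (-s))) ≤ r := fun s hs => by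
      rw [neg_neg]
      exact hd _ ⟨by linarith [hs.2], by linarith [hs.1]⟩
    have hA' : f (- -p) ∈ A ∨ f (- -g (- -p)) ∈ A := by simpa using hA
    constructor
    · intro hp
      have := h.comp_neg.shift_gt hAc hη hη' (hmono.orderIsoOfSurjective _ hsurj)
        (neg_le_neg hcp) hd' hA' (by simp; linarith)
      simp at this
      linarith
    · intro hp
      have := h.comp_neg.shift_lt hAc hη hη' hmono
        (hmono.orderIsoOfSurjective _ hsurj).continuous
        (neg_le_neg hcp) hd' hA' (by simp; linarith)
      simp at this
      linarith

theorem LocalFiberedFlow.exists_dist_lt [CompactSpace K] (L : LocalFiberedFlow K d k)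
    {ε : ℝ} (hε : 0 < ε) :
    ∃ η > 0, ∀ u, |u| ≤ η → ∀ y, dist y (L.φ u y) < ε := by
  have huc := (isCompact_Icc (a := (-1 : ℝ)) (b := 1)).prod
    (isCompact_univ (X := K)) |>.uniformContinuousOn_of_continuous L.φ_cont.continuousOn
  obtain ⟨δ, hδ, H⟩ := Metric.uniformContinuousOn_iff.1 huc ε hε
  refine ⟨min 1 (δ / 2), by positivity, fun u hu y => ?_⟩
  have hu1 : |u| ≤ 1 := hu.trans (min_le_left _ _)
  have hu2 : |u| ≤ δ / 2 := hu.trans (min_le_right _ _)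
  have := H (0, y) ⟨by simp, mem_univ _⟩ (u, y) ⟨abs_le.1 hu1, mem_univ _⟩ (by
    rw [Prod.dist_eq, dist_self, dist_comm, Real.dist_eq, sub_zero]
    exact max_lt (by linarith) hδ)
  simpa [L.φ_zero] using this

/-- Orbits of a compatible flow are uniformly transverse to the closure of `U`. -/
theorem Compatible.exists_transverseCurve [CompactSpace K] {L : LocalFiberedFlow K d k}
    {U : Set K} {ident : Identification L U} (hUo : IsOpen U) (hcomp : Compatible L U ident) :
    ∃ η r : ℝ, 0 < η ∧ η ≤ 1 / 4 ∧ 0 < r ∧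
      ∀ x, TransverseCurve (fun s => L.φ s x) (closure U) η r := by
  obtain ⟨r₁, hr₁, H₁⟩ := hcomp.no_small_period (1 / 2) (by norm_num)
  obtain ⟨η', hη', Hη⟩ := L.exists_dist_lt (ε := r₁ / 4) (by positivity)
  obtain ⟨η, hη, hη4, hηη'⟩ : ∃ η > 0, η ≤ 1 / 4 ∧ 2 * η ≤ η' :=
    ⟨min (1 / 4) (η' / 2), by positivity, min_le_left _ _, by
      linarith [min_le_right (1 / 4) (η' / 2)]⟩
  obtain ⟨r₂, hr₂, H₂⟩ := hcomp.no_small_period η hη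
  have hcont : ∀ t, Continuous (L.φ t) := fun t =>
    L.φ_cont.comp (continuous_const.prodMk continuous_id)
  obtain ⟨r₃, hr₃, H₃⟩ : ∃ r₃ > 0, ∀ y ∈ closure U, ∀ z, dist y z < r₃ →
      ∃ u, |u| ≤ η ∧ L.φ u z ∈ U := by
    have hclosed : IsClosed {z | ∀ s ∈ Icc (-η) η, L.φ s z ∉ U} := by
      simp only [ofPred_forall]
      exact isClosed_biInter fun s _ => hUo.isClosed_compl.preimage (hcont s)
    have hdisj : Disjoint (closure U) {z | ∀ s ∈ Icc (-η) η, L.φ s z ∉ U} :=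
      Set.disjoint_left.2 fun z hz hz' => hcomp.transverse_boundary z η hη hz' hz
    obtain ⟨δ, hδ, hdis⟩ := hdisj.exists_thickenings isClosed_closure.isCompact hclosed
    refine ⟨δ, hδ, fun y hy z hyz => ?_⟩
    by_contra! hz
    have hzS : z ∈ {z | ∀ s ∈ Icc (-η) η, L.φ s z ∉ U} := fun s hs => hz s (abs_le.2 hs)
    refine Set.disjoint_left.1 hdis ?_ (self_subset_thickening hδ _ hzS)
    exact mem_thickening_iff.2 ⟨y, hy, by rwa [dist_comm]⟩
  have huc : ∀ t, ∃ δ > 0, ∀ y z, dist y z < δ → dist (L.φ t y) (L.φ t z) < r₁ / 4 :=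
    fun t => by
      obtain ⟨δ, hδ, H⟩ := Metric.uniformContinuous_iff.1
        (CompactSpace.uniformContinuous_of_continuous (hcont t)) (r₁ / 4) (by positivity)
      exact ⟨δ, hδ, fun y z h => H h⟩
  obtain ⟨δp, hδp, Hp⟩ := huc 1
  obtain ⟨δm, hδm, Hm⟩ := huc (-1)
  obtain ⟨r, hr, h1, h2, h3, h4, h5⟩ :
      ∃ r > 0, r ≤ r₁ / 16 ∧ r < r₂ ∧ r < r₃ ∧ r < δp ∧ r < δm := by
    have hm : 0 < min (min (min (r₁ / 8) r₂) (min r₃ δp)) δm := by positivity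
    refine ⟨min (min (min (r₁ / 8) r₂) (min r₃ δp)) δm / 2, by positivity, ?_⟩
    have hlt := half_lt_self hm
    have h' : min (min (min (r₁ / 8) r₂) (min r₃ δp)) δm ≤ r₁ / 8 := by simp
    simp only [lt_min_iff] at hlt
    exact ⟨by linarith, hlt.1.1.2, hlt.1.2.1, hlt.1.2.2, hlt.2⟩
  refine ⟨η, r, hη, hη4, hr, fun x => ⟨?_, ?_, ?_, ?_⟩⟩
  · exact L.φ_cont.comp (continuous_id.prodMk continuous_const)
  · intro s u hs hu hd
    refine H₂ _ hs u (abs_le.1 hu) ?_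
    rw [← L.φ_add, add_comm]
    exact hd.trans_lt h2
  · intro s s' hs hd
    obtain ⟨u, hu, hU⟩ := H₃ _ hs _ (hd.trans_lt h3)
    refine ⟨u, hu, subset_closure ?_⟩
    rwa [add_comm, L.φ_add]
  · intro e s s' v he hA hd hd' hv
    have hunit : ∀ y ∈ closure U, ¬ dist y (L.φ e y) < r₁ := fun y hy hlt => by
      have := H₁ y hy e (abs_le.1 (by linarith)) hlt
      linarith
    have hsv : dist (L.φ s' x) (L.φ v x) < r₁ / 4 := by
      have := Hη (v - s') (hv.trans hηη') (L.φ s' x)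
      rwa [← L.φ_add, sub_add_cancel] at this
    have hse : dist (L.φ s x) (L.φ (s + e) x) < r₁ / 2 := by
      have t1 := dist_triangle4 (L.φ s x) (L.φ s' x) (L.φ v x) (L.φ (s + e) x)
      rw [dist_comm (L.φ v x)] at t1
      linarith
    rw [add_comm, L.φ_add] at hse
    rcases hA with hA | hA
    · exact hunit _ hA (by linarith)
    · refine hunit _ hA ?_
      have hmove : dist (L.φ e (L.φ s x)) (L.φ e (L.φ s' x)) < r₁ / 4 := by
        rcases (abs_eq zero_le_one).1 he with rfl | rfl
        · exact Hp _ _ (hd.trans_lt h4)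
        · exact Hm _ _ (hd.trans_lt h5)
      have t1 := dist_triangle4 (L.φ s' x) (L.φ s x) (L.φ e (L.φ s x)) (L.φ e (L.φ s' x))
      rw [dist_comm (L.φ s' x) (L.φ s x)] at t1
      linarith

/-- Proposition 3.5 of the paper, "no shear inside orbits":
after possibly decreasing the constant `r₀` of the identification, two
reparametrizations of the same orbit which shadow each other cannot shift by
an intermediate amount. -/
theorem statement9 {K : Type} [MetricSpace K] [CompactSpace K] {d : ℕ}
    (L : LocalFiberedFlow K d 1) (U : Set K) (hUopen : IsOpen U)
    (ident : Identification L U) (hcomp : Compatible L U ident) :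
    ∃ r₀' : ℝ, 0 < r₀' ∧ r₀' ≤ ident.r₀ ∧
      ∀ x ∈ U, ∀ θ : ℝ → ℝ, StrictMono θ → Function.Surjective θ →
      ∀ I : Set ℝ, I.OrdConnected → (0:ℝ) ∈ I →
      L.φ (θ 0) x ∈ U →
      (∀ t ∈ I, dist (L.φ t x) (L.φ (θ t) x) ≤ r₀') →
      ((θ 0 > 1/2 →
          ∀ t ∈ I, L.φ t x ∈ U → L.φ (θ t) x ∈ U → θ t > t + 2) ∧
       (θ 0 ∈ Set.Icc (-2:ℝ) 2 →
          ∀ t ∈ I, L.φ t x ∈ U → L.φ (θ t) x ∈ U → θ t ∈ Set.Icc (t - 1/2) (t + 1/2)) ∧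
       (θ 0 < -1/2 →
          ∀ t ∈ I, L.φ t x ∈ U → L.φ (θ t) x ∈ U → θ t < t - 2)) := by
  obtain ⟨η, r, hη, hη4, hr, hcurve⟩ := hcomp.exists_transverseCurve hUopen
  refine ⟨min r ident.r₀, lt_min hr ident.r₀_pos, min_le_right _ _, ?_⟩
  intro x hx θ hθ hθs I hI h0 hθ0 hd
  have hclose : ∀ t ∈ I, dist (L.φ t x) (L.φ (θ t) x) ≤ r := fun t ht =>
    (hd t ht).trans (min_le_left _ _)
  have hx0 : L.φ 0 x ∈ closure U := by rw [L.φ_zero]; exact subset_closure hx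
  have hshort : ∀ t ∈ I, L.φ t x ∈ closure U → |θ t - t| ≤ 2 → |θ t - t| < η :=
    fun t ht hA hle => (hcurve x).no_short_return t _ hA hle (by
      rw [add_sub_cancel]; exact hclose t ht)
  have hsign : ∀ p ∈ I, ∀ c ∈ I, L.φ p x ∈ closure U →
      (p + 2 ≤ θ p → c + η < θ c) ∧ (θ p + 2 ≤ p → θ c + η < c) := fun p hp c hc hA =>
    (hcurve x).shift_sign isClosed_closure hη hη4 (hθ.orderIsoOfSurjective θ hθs)
      (fun s hs => hclose s (hI.uIcc_subset hp hc hs)) (Or.inl hA)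
  have hs0 := hshort 0 h0 hx0
  rw [sub_zero] at hs0
  refine ⟨fun h t ht htU _ => ?_, fun h t ht htU _ => ?_, fun h t ht htU _ => ?_⟩
  · have h2 : 2 < θ 0 := by
      by_contra! hle
      have := hs0 (abs_le.2 ⟨by linarith, hle⟩)
      linarith [le_abs_self (θ 0)]
    have h3 := (hsign 0 h0 t ht hx0).1 (by linarith)
    by_contra! hle
    have := hshort t ht (subset_closure htU) (abs_le.2 ⟨by linarith, by linarith⟩)
    linarith [le_abs_self (θ t - t)]
  · obtain ⟨h1, h2⟩ := abs_lt.1 (hs0 (abs_le.2 h))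
    obtain ⟨hp, hn⟩ := hsign t ht 0 h0 (subset_closure htU)
    have hle : |θ t - t| ≤ 2 := by
      refine abs_le.2 ⟨?_, ?_⟩
      · by_contra! hlt
        linarith [hn (by linarith)]
      · by_contra! hlt
        linarith [hp (by linarith)]
    obtain ⟨h3, h4⟩ := abs_lt.1 (hshort t ht (subset_closure htU) hle)
    exact ⟨by linarith, by linarith⟩
  · have h2 : θ 0 < -2 := by
      by_contra! hle
      have := hs0 (abs_le.2 ⟨hle, by linarith⟩)
      linarith [neg_abs_le (θ 0)]
    have h3 := (hsign 0 h0 t ht hx0).2 (by linarith)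
    by_contra! hle
    have := hshort t ht (subset_closure htU) (abs_le.2 ⟨by linarith, by linarith⟩)
    linarith [neg_abs_le (θ t - t)]
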